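/- The multiple Hermite polynomials satisfy the Turán inequality H_{n⃗+e⃗_j}(x)² − H_{n⃗}(x) · H_{n⃗+2e⃗_j}(x) > 0 for all x ∈ ℝ, for every multi-index n⃗ ∈ ℕ^r and every j ∈ {1, …, r}. -/

import Mathlib

open MeasureTheory Polynomial Finset

/-- `P` is the multiple Hermite polynomial for the (pairwise distinct) parameters `c`
and the multi-index `n`: it is monic of degree `|n|` and satisfies
`∫ x^k P(x) exp(-x² + c j x) dx = 0` for all `k < n j` and all `j`. -/
def IsMultipleHermite {r : ℕ} (c : Fin r → ℝ) (n : Fin r → ℕ)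
    (P : Polynomial ℝ) : Prop :=
  P.Monic ∧ P.natDegree = ∑ i, n i ∧
    ∀ j : Fin r, ∀ k < n j,
      ∫ x : ℝ, x ^ k * P.eval x * Real.exp (-x ^ 2 + c j * x) = 0

/-- The `j`-th standard unit multi-index `e⃗_j` in `ℕ^r`. -/
def unitMI {r : ℕ} (j : Fin r) : Fin r → ℕ := fun i => if i = j then 1 else 0

/-! ### The Gaussian functional -/

lemma integrable_poly_w (c : ℝ) (P : ℝ[X]) :
    Integrable (fun x : ℝ => P.eval x * Real.exp (-x ^ 2 + c * x)) := by
  induction P using Polynomial.induction_on' with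
  | add p q hp hq =>
    have := hp.add hq
    refine this.congr (Filter.Eventually.of_forall fun x => ?_)
    simp only [Pi.add_apply, eval_add]; ring
  | monomial k a =>
    have h1 := (integrable_rpow_mul_exp_neg_mul_sq (b := 1 / 2) (by norm_num) (s := (k : ℝ))
      (by have : (0 : ℝ) ≤ k := k.cast_nonneg
          linarith)).norm.const_mul (|a| * Real.exp (c ^ 2 / 2))
    refine h1.mono' (by fun_prop) (Filter.Eventually.of_forall fun x => ?_)
    simp only [eval_monomial, Real.rpow_natCast, norm_mul, Real.norm_eq_abs, Real.abs_exp]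
    have h2 : Real.exp (-x ^ 2 + c * x) ≤ Real.exp (c ^ 2 / 2) * Real.exp (-(1 / 2) * x ^ 2) := by
      rw [← Real.exp_add]
      apply Real.exp_le_exp.2
      nlinarith [sq_nonneg (x - c)]
    calc |a| * |x ^ k| * Real.exp (-x ^ 2 + c * x)
        ≤ |a| * |x ^ k| * (Real.exp (c ^ 2 / 2) * Real.exp (-(1 / 2) * x ^ 2)) := by gcongr
      _ = _ := by ring

/-- The Gaussian functional. -/
noncomputable def gaussL (c : ℝ) : ℝ[X] →ₗ[ℝ] ℝ where
  toFun P := ∫ x : ℝ, P.eval x * Real.exp (-x ^ 2 + c * x)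
  map_add' p q := by
    rw [← integral_add (integrable_poly_w c p) (integrable_poly_w c q)]
    congr 1; ext x; rw [eval_add]; ring
  map_smul' a p := by
    simp only [eval_smul, smul_eq_mul, RingHom.id_apply]
    rw [← integral_const_mul]
    congr 1; ext x; ring

lemma gaussL_apply (c : ℝ) (P : ℝ[X]) :
    gaussL c P = ∫ x : ℝ, P.eval x * Real.exp (-x ^ 2 + c * x) := rfl

lemma gaussL_C_mul (c a : ℝ) (P : ℝ[X]) : gaussL c (C a * P) = a * gaussL c P := by
  rw [← smul_eq_C_mul, map_smul, smul_eq_mul]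

lemma gaussL_parts (c : ℝ) (P : ℝ[X]) :
    gaussL c (derivative P + (C c - C 2 * X) * P) = 0 := by
  rw [gaussL_apply]
  refine integral_eq_zero_of_hasDerivAt_of_integrable
    (f := fun x : ℝ => P.eval x * Real.exp (-x ^ 2 + c * x)) (fun x => ?_)
    (integrable_poly_w c _) (integrable_poly_w c _)
  have h1 : HasDerivAt (fun x : ℝ => -x ^ 2 + c * x) (-(2 * x) + c) x := by
    have := ((hasDerivAt_pow 2 x).neg).add ((hasDerivAt_id x).const_mul c)
    refine this.congr_deriv ?_
    norm_num
  refine ((P.hasDerivAt x).mul h1.exp).congr_deriv ?_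
  simp only [eval_add, eval_mul, eval_sub, eval_C, eval_X]
  ring

lemma gaussL_X_mul (c : ℝ) (P : ℝ[X]) :
    gaussL c (X * P) = c / 2 * gaussL c P + 1 / 2 * gaussL c (derivative P) := by
  have h := gaussL_parts c P
  have e : derivative P + (C c - C 2 * X) * P
      = derivative P + C c * P - C 2 * (X * P) := by ring
  rw [e, map_sub, map_add, gaussL_C_mul, gaussL_C_mul] at h
  linarith

/-! ### The transform of a polynomial -/

/-- `D F = F' + (X/2) F`. -/
noncomputable def opD : Module.End ℝ ℝ[X] :=
  derivative + LinearMap.mulLeft ℝ (C (1 / 2) * X)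

lemma opD_apply (F : ℝ[X]) : opD F = derivative F + C (1 / 2) * X * F := rfl

/-- The transform `P ↦ P(D) 1`. -/
noncomputable def opT (P : ℝ[X]) : ℝ[X] := (aeval opD P) 1

lemma opT_add (P Q : ℝ[X]) : opT (P + Q) = opT P + opT Q := by simp [opT]

lemma opT_C_mul (a : ℝ) (P : ℝ[X]) : opT (C a * P) = C a * opT P := by
  simp [opT, Algebra.smul_def, Module.algebraMap_end_apply]

lemma opT_C (a : ℝ) : opT (C a) = C a := by
  simp [opT, Module.algebraMap_end_apply, smul_eq_C_mul]

lemma opT_X_mul (P : ℝ[X]) : opT (X * P) = derivative (opT P) + C (1 / 2) * X * opT P := by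
  rw [← opD_apply]; simp [opT]

lemma opT_derivative (P : ℝ[X]) : derivative (opT P) = C (1 / 2) * opT (derivative P) := by
  have mono : ∀ k : ℕ, derivative (opT (X ^ k)) = C (1 / 2) * opT (derivative (X ^ k : ℝ[X])) := by
    intro k
    induction k with
    | zero => 
      have := opT_C 1
      have h0 := opT_C 0
      simp only [C_1, C_0] at this h0
      simp [this, h0]
    | succ k ih =>
      rw [pow_succ', opT_X_mul, derivative_mul (f := X), derivative_X, one_mul, opT_add,
        opT_X_mul, derivative_add, ih]
      simp only [derivative_mul, derivative_C, derivative_X, ih]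
      ring
  induction P using Polynomial.induction_on' with
  | add p q hp hq => rw [opT_add, derivative_add, derivative_add, hp, hq, opT_add]; ring
  | monomial k a =>
    rw [← C_mul_X_pow_eq_monomial, opT_C_mul, derivative_C_mul, derivative_C_mul, opT_C_mul, mono]
    ring

lemma opT_natDegree (P : ℝ[X]) : (opT P).natDegree ≤ P.natDegree := by
  have mono : ∀ k : ℕ, (opT (X ^ k)).natDegree ≤ k := by
    intro k
    induction k with
    | zero =>
      have := opT_C 1
      simp only [C_1] at this
      simp [this]
    | succ k ih =>
      rw [pow_succ', opT_X_mul]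
      refine natDegree_add_le_of_degree_le ?_ ?_
      · have := natDegree_derivative_le (opT (X ^ k))
        omega
      · refine natDegree_mul_le.trans ?_
        have : (C (1 / 2 : ℝ) * X).natDegree ≤ 1 := (natDegree_C_mul_le _ _).trans natDegree_X_le
        omega
  have key : opT P = ∑ k ∈ range (P.natDegree + 1), C (P.coeff k) * opT (X ^ k) := by
    conv_lhs => rw [P.as_sum_range_C_mul_X_pow]
    rw [opT, map_sum, LinearMap.sum_apply]
    exact sum_congr rfl fun k _ => opT_C_mul _ _
  rw [key]
  refine natDegree_sum_le_of_forall_le _ _ fun k hk => ?_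
  refine (natDegree_C_mul_le _ _).trans ((mono k).trans ?_)
  have := mem_range.1 hk
  omega

lemma opT_injective (N : ℕ) : ∀ P : ℝ[X], P.natDegree ≤ N → opT P = 0 → P = 0 := by
  induction N with
  | zero =>
    intro P hP h
    rw [eq_C_of_natDegree_le_zero hP] at h ⊢
    rwa [opT_C] at h
  | succ N ih =>
    intro P hP h
    have h1 : opT (derivative P) = 0 := by
      have := opT_derivative P
      rw [h, derivative_zero] at this
      have h2 := mul_eq_zero.1 this.symm
      rcases h2 with h2 | h2
      · rw [C_eq_zero] at h2; norm_num at h2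
      · exact h2
    have h3 := ih _ (by have := natDegree_derivative_le P; omega) h1
    have h4 := natDegree_eq_zero_of_derivative_eq_zero h3
    rw [eq_C_of_natDegree_eq_zero h4] at h ⊢
    rwa [opT_C] at h

lemma gaussL_eq (c : ℝ) (N : ℕ) : ∀ P : ℝ[X], P.natDegree ≤ N →
    gaussL c P = (opT P).eval c * gaussL c 1 := by
  have const : ∀ a : ℝ, gaussL c (C a) = a * gaussL c 1 := fun a => by
    rw [← gaussL_C_mul, mul_one]
  induction N with
  | zero =>
    intro P hP
    rw [eq_C_of_natDegree_le_zero hP, opT_C, const, eval_C]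
  | succ N ih =>
    intro P hP
    have hd : P.divX.natDegree ≤ N := by rw [natDegree_divX_eq_natDegree_tsub_one]; omega
    have hd' : (derivative P.divX).natDegree ≤ N := by
      have := natDegree_derivative_le P.divX; omega
    rw [← X_mul_divX_add P, map_add, gaussL_X_mul, ih _ hd, ih _ hd', const, opT_add, opT_C,
      opT_X_mul, opT_derivative]
    simp only [eval_add, eval_mul, eval_C, eval_X]
    ring

/-! ### Uniqueness -/

lemma gaussL_deriv_orth (c : ℝ) (m : ℕ) (P : ℝ[X])
    (h : ∀ k < m + 1, gaussL c (X ^ k * P) = 0) :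
    ∀ k < m, gaussL c (X ^ k * derivative P) = 0 := by
  intro k hk
  have hp := gaussL_parts c (X ^ k * P)
  have e : derivative (X ^ k * P) + (C c - C 2 * X) * (X ^ k * P)
      = C (k : ℝ) * (X ^ (k - 1) * P) + X ^ k * derivative P + C c * (X ^ k * P)
        - C 2 * (X ^ (k + 1) * P) := by
    rw [derivative_mul, derivative_X_pow]; ring
  rw [e, map_sub, map_add, map_add, gaussL_C_mul, gaussL_C_mul, gaussL_C_mul,
    h (k - 1) (by omega), h k (by omega), h (k + 1) (by omega)] at hp
  linarith

lemma gaussL_iterate_orth (c : ℝ) (i : ℕ) : ∀ (m : ℕ) (P : ℝ[X]),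
    (∀ k < m + i, gaussL c (X ^ k * P) = 0) →
    ∀ k < m, gaussL c (X ^ k * derivative^[i] P) = 0 := by
  induction i with
  | zero => intro m P h; simpa using h
  | succ i ih =>
    intro m P h
    rw [Function.iterate_succ_apply]
    exact ih m _ (gaussL_deriv_orth c (m + i) P h)

lemma gaussL_one_pos (c : ℝ) : 0 < gaussL c 1 := by
  rw [gaussL_apply]
  have := integrable_poly_w c 1
  simp only [eval_one, one_mul] at this ⊢
  exact integral_exp_pos this

lemma opT_iterate (i : ℕ) (P : ℝ[X]) :
    derivative^[i] (opT P) = C ((1 / 2) ^ i) * opT (derivative^[i] P) := by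
  induction i with
  | zero => simp
  | succ i ih =>
    rw [Function.iterate_succ_apply', Function.iterate_succ_apply', ih, derivative_C_mul,
      opT_derivative, pow_succ, C_mul, mul_assoc]

lemma opT_dvd (c : ℝ) (m : ℕ) (P : ℝ[X]) (h : ∀ k < m, gaussL c (X ^ k * P) = 0) :
    (X - C c) ^ m ∣ opT P := by
  by_cases h0 : opT P = 0
  · rw [h0]; exact dvd_zero _
  rcases m with _ | m
  · simp
  rw [← le_rootMultiplicity_iff h0]
  refine lt_rootMultiplicity_of_isRoot_iterate_derivative h0 fun i hi => ?_
  have h1 := gaussL_iterate_orth c i (m + 1 - i) P (fun k hk => h k (by omega)) 0 (by omega)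
  rw [pow_zero, one_mul, gaussL_eq c _ _ le_rfl] at h1
  have h2 := (mul_eq_zero.1 h1).resolve_right (gaussL_one_pos c).ne'
  rw [IsRoot, opT_iterate, eval_mul, h2, mul_zero]

lemma orth_unique {r : ℕ} (c : Fin r → ℝ) (hc : Function.Injective c) (n : Fin r → ℕ)
    (P : ℝ[X]) (hdeg : P ≠ 0 → P.natDegree < ∑ i, n i)
    (h : ∀ j, ∀ k < n j, gaussL (c j) (X ^ k * P) = 0) : P = 0 := by
  by_contra hP
  have hd := hdeg hP
  have hdvd : (∏ j, (X - C (c j)) ^ n j) ∣ opT P := by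
    refine Finset.prod_dvd_of_coprime ?_ fun j _ => opT_dvd _ _ _ (h j)
    intro i _ j _ hij
    exact (pairwise_coprime_X_sub_C hc hij).pow
  have hT : opT P ≠ 0 := fun h0 => hP (opT_injective _ P le_rfl h0)
  have h1 := natDegree_le_of_dvd hdvd hT
  rw [natDegree_prod_of_monic _ _ (fun j _ => (monic_X_sub_C _).pow _)] at h1
  simp only [natDegree_pow, natDegree_X_sub_C, mul_one] at h1
  have := opT_natDegree P
  omega

/-! ### The raising operator -/

/-- The raising operator. -/
noncomputable def raise (a : ℝ) (P : ℝ[X]) : ℝ[X] := (X - C a) * P - C (1 / 2) * derivative P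

lemma raise_monic (a : ℝ) (P : ℝ[X]) (hP : P.Monic) :
    (raise a P).Monic ∧ (raise a P).natDegree = P.natDegree + 1 := by
  have hm : ((X - C a) * P).Monic := (monic_X_sub_C a).mul hP
  have hd : ((X - C a) * P).natDegree = P.natDegree + 1 := by
    rw [(monic_X_sub_C a).natDegree_mul hP, natDegree_X_sub_C, add_comm]
  have hl : (C (1 / 2 : ℝ) * derivative P).natDegree < ((X - C a) * P).natDegree := by
    rw [hd]
    have h1 := natDegree_C_mul_le (1 / 2 : ℝ) (derivative P)
    have h2 := natDegree_derivative_le P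
    omega
  refine ⟨hm.sub_of_left (degree_lt_degree hl), ?_⟩
  rw [raise, natDegree_sub_eq_left_of_natDegree_lt hl, hd]

lemma isMH_orth {r : ℕ} {c : Fin r → ℝ} {n : Fin r → ℕ} {P : ℝ[X]}
    (h : IsMultipleHermite c n P) : ∀ j, ∀ k < n j, gaussL (c j) (X ^ k * P) = 0 := by
  intro j k hk
  rw [gaussL_apply]
  simpa using h.2.2 j k hk

lemma raise_orth {r : ℕ} (c : Fin r → ℝ) (n : Fin r → ℕ) (P : ℝ[X]) (l : Fin r)
    (h : ∀ j, ∀ k < n j, gaussL (c j) (X ^ k * P) = 0) :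
    ∀ j, ∀ k < (n + unitMI l) j, gaussL (c j) (X ^ k * raise (c l / 2) P) = 0 := by
  intro j k hk
  have hp := gaussL_parts (c j) (X ^ k * P)
  have hC : C (c l) = 2 * C (c l / 2) := by
    rw [← C_ofNat, ← C_mul]; congr 1; ring
  have h2 : (2 : ℝ[X]) * C (1 / 2) = 1 := by
    rw [← C_ofNat, ← C_mul]; norm_num
  have e : derivative (X ^ k * P) + (C (c j) - C 2 * X) * (X ^ k * P)
      = C (k : ℝ) * (X ^ (k - 1) * P) + C (c j - c l) * (X ^ k * P)
        - C 2 * (X ^ k * raise (c l / 2) P) := by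
    rw [derivative_mul, derivative_X_pow, raise, C_sub, hC, C_ofNat]
    linear_combination (- X ^ k * derivative P) * h2
  rw [e, map_sub, map_add, gaussL_C_mul, gaussL_C_mul, gaussL_C_mul] at hp
  have t1 : (k : ℝ) * gaussL (c j) (X ^ (k - 1) * P) = 0 := by
    rcases k with _ | k
    · simp
    · rw [h j _ (by
        simp only [Pi.add_apply, unitMI] at hk
        split_ifs at hk <;> omega), mul_zero]
  have t2 : (c j - c l) * gaussL (c j) (X ^ k * P) = 0 := by
    by_cases hjl : j = l
    · rw [hjl, sub_self, zero_mul]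
    · rw [h j k (by simpa [unitMI, hjl] using hk), mul_zero]
  rw [t1, t2] at hp
  linarith

lemma MH_raise {r : ℕ} (c : Fin r → ℝ) (hc : Function.Injective c)
    (H : (Fin r → ℕ) → ℝ[X]) (hH : ∀ n, IsMultipleHermite c n (H n))
    (n : Fin r → ℕ) (l : Fin r) : H (n + unitMI l) = raise (c l / 2) (H n) := by
  obtain ⟨hm, hd⟩ := raise_monic (c l / 2) (H n) (hH n).1
  have hs : ∑ i, (n + unitMI l) i = (∑ i, n i) + 1 := by
    simp [unitMI, sum_add_distrib]
  have hd2 := (hH (n + unitMI l)).2.1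
  rw [hs] at hd2
  rw [(hH n).2.1] at hd
  rw [← sub_eq_zero]
  refine orth_unique c hc (n + unitMI l) _ (fun h0 => ?_) fun j k hk => ?_
  · rw [hs]
    have := degree_sub_lt (p := H (n + unitMI l)) (q := raise (c l / 2) (H n))
      (by rw [degree_eq_natDegree (hH _).1.ne_zero, degree_eq_natDegree hm.ne_zero, hd, hd2])
      (hH _).1.ne_zero (by rw [(hH _).1.leadingCoeff, hm.leadingCoeff])
    have h3 := natDegree_lt_natDegree h0 this
    omega
  · rw [mul_sub, map_sub, isMH_orth (hH _) j k hk,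
      raise_orth c n (H n) l (isMH_orth (hH n)) j k hk, sub_zero]

/-! ### Real-rootedness -/

/-- Monic polynomial with the given real zeros. -/
noncomputable def ofRoots (s : Multiset ℝ) : ℝ[X] := (s.map fun a => X - C a).prod

lemma ofRoots_cons (a : ℝ) (s : Multiset ℝ) :
    ofRoots (a ::ₘ s) = (X - C a) * ofRoots s := by simp [ofRoots]

lemma laguerre (s : Multiset ℝ) (x : ℝ) :
    0 ≤ (derivative (ofRoots s)).eval x ^ 2
      - (ofRoots s).eval x * (derivative (derivative (ofRoots s))).eval x := by
  induction s using Multiset.induction_on with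
  | empty => simp [ofRoots]
  | cons a s ih =>
    rw [ofRoots_cons]
    simp only [derivative_mul, derivative_sub, derivative_X, derivative_C, derivative_add,
      eval_add, eval_mul, eval_sub, eval_X, eval_C, sub_zero, one_mul, derivative_one,
      zero_mul, zero_add]
    nlinarith [mul_nonneg (sq_nonneg (x - a)) ih, sq_nonneg ((ofRoots s).eval x)]

lemma im_log_deriv (s : Multiset ℝ) (z : ℂ) :
    (aeval z (derivative (ofRoots s)) * (starRingEnd ℂ) (aeval z (ofRoots s))).im * z.im ≤ 0 := by
  induction s using Multiset.induction_on with
  | empty => simp [ofRoots]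
  | cons a s ih =>
    rw [ofRoots_cons]
    simp only [derivative_mul, derivative_sub, derivative_X, derivative_C, map_add, map_mul,
      map_sub, aeval_X, aeval_C, sub_zero, one_mul]
    set R := aeval z (ofRoots s)
    set R' := aeval z (derivative (ofRoots s))
    simp only [Complex.coe_algebraMap, Complex.conj_ofReal, Complex.mul_im, Complex.mul_re,
      Complex.add_im, Complex.add_re, Complex.sub_im, Complex.sub_re, Complex.conj_im,
      Complex.conj_re, Complex.ofReal_im, Complex.ofReal_re] at ih ⊢
    have e1 := mul_nonneg (add_nonneg (sq_nonneg R.re) (sq_nonneg R.im)) (sq_nonneg z.im)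
    have e2 := mul_nonneg (add_nonneg (sq_nonneg (z.re - a)) (sq_nonneg z.im)) (neg_nonneg.2 ih)
    nlinarith [e1, e2]

lemma ofRoots_real (s : Multiset ℝ) (z : ℂ) (h : aeval z (ofRoots s) = 0) : z.im = 0 := by
  induction s using Multiset.induction_on with
  | empty => simp [ofRoots] at h
  | cons a s ih =>
    rw [ofRoots_cons, map_mul] at h
    rcases mul_eq_zero.1 h with h | h
    · simp only [map_sub, aeval_X, aeval_C, Complex.coe_algebraMap] at h
      rw [sub_eq_zero.1 h, Complex.ofReal_im]
    · exact ih h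

lemma exists_ofRoots (N : ℕ) : ∀ Q : ℝ[X], Q.natDegree = N → Q.Monic →
    (∀ z : ℂ, aeval z Q = 0 → z.im = 0) → ∃ s, Q = ofRoots s := by
  induction N with
  | zero =>
    intro Q hN hQ _
    exact ⟨0, by simpa [ofRoots] using hQ.natDegree_eq_zero.1 hN⟩
  | succ N ih =>
    intro Q hN hQ hz
    obtain ⟨z, hz0⟩ := IsAlgClosed.exists_aeval_eq_zero ℂ Q (by
      rw [degree_eq_natDegree hQ.ne_zero, hN]; exact_mod_cast Nat.succ_ne_zero N)
    have him := hz z hz0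
    have hzr : z = ((z.re : ℝ) : ℂ) := Complex.ext (by simp) (by simp [him])
    have hroot : Q.IsRoot z.re := by
      rw [hzr, ← Complex.coe_algebraMap, aeval_algebraMap_apply] at hz0
      simpa using hz0
    obtain ⟨R, hR⟩ := dvd_iff_isRoot.2 hroot
    have hRm : R.Monic := (monic_X_sub_C z.re).of_mul_monic_left (hR ▸ hQ)
    have hRd : R.natDegree = N := by
      have := (monic_X_sub_C z.re).natDegree_mul hRm
      rw [← hR, natDegree_X_sub_C] at this
      omega
    obtain ⟨s, hs⟩ := ih R hRd hRm fun w hw => hz w (by rw [hR, map_mul, hw, mul_zero])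
    exact ⟨z.re ::ₘ s, by rw [ofRoots_cons, ← hs, hR]⟩

/-- Real and simple zeros. -/
def GoodPoly (P : ℝ[X]) : Prop :=
  (∃ s, P = ofRoots s) ∧ ∀ x, P.eval x = 0 → (derivative P).eval x ≠ 0

lemma GoodPoly.pos {P : ℝ[X]} (h : GoodPoly P) (x : ℝ) :
    0 < 2 * P.eval x ^ 2 + ((derivative P).eval x ^ 2
      - P.eval x * (derivative (derivative P)).eval x) := by
  obtain ⟨⟨s, rfl⟩, h2⟩ := h
  by_cases h0 : (ofRoots s).eval x = 0
  · have := h2 x h0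
    rw [h0]
    have := sq_pos_of_ne_zero this
    linarith
  · have := laguerre s x
    have := sq_pos_of_ne_zero h0
    linarith

lemma GoodPoly.raise {P : ℝ[X]} (hm : P.Monic) (h : GoodPoly P) (a : ℝ) :
    GoodPoly (raise a P) := by
  refine ⟨exists_ofRoots _ _ rfl (raise_monic a P hm).1 ?_, ?_⟩
  · obtain ⟨⟨s, rfl⟩, -⟩ := h
    intro z hz
    by_contra hne
    have hP : aeval z (ofRoots s) ≠ 0 := fun h0 => hne (ofRoots_real s z h0)
    have hl := im_log_deriv s z
    have hD : aeval z (derivative (ofRoots s)) = 2 * ((z - a) * aeval z (ofRoots s)) := by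
      simp only [_root_.raise, map_sub, map_mul, aeval_X, aeval_C, Complex.coe_algebraMap] at hz
      push_cast at hz
      linear_combination (-2) * hz
    rw [hD, show 2 * ((z - a) * aeval z (ofRoots s)) * (starRingEnd ℂ) (aeval z (ofRoots s))
      = (z - a) * ((2 * Complex.normSq (aeval z (ofRoots s)) : ℝ) : ℂ) by
        push_cast; rw [Complex.normSq_eq_conj_mul_self]; ring, Complex.im_mul_ofReal] at hl
    simp only [Complex.sub_im, Complex.ofReal_im, sub_zero] at hl
    have h1 := Complex.normSq_pos.2 hP
    have h2 := sq_pos_of_ne_zero hne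
    nlinarith [mul_pos h1 h2]
  · intro x h0 h1
    have hp := h.pos x
    simp only [_root_.raise, derivative_sub, derivative_mul, derivative_X, derivative_C, eval_sub,
      eval_mul, eval_add, eval_X, eval_C, sub_zero, one_mul, zero_mul, zero_add, eval_one] at h0 h1
    have hz : 2 * P.eval x ^ 2 + ((derivative P).eval x ^ 2
        - P.eval x * (derivative (derivative P)).eval x) = 0 := by
      linear_combination (2 * P.eval x) * h1 - (2 * (derivative P).eval x) * h0
    exact hp.ne' hz

lemma MH_good {r : ℕ} (c : Fin r → ℝ) (hc : Function.Injective c)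
    (H : (Fin r → ℕ) → ℝ[X]) (hH : ∀ n, IsMultipleHermite c n (H n)) (N : ℕ) :
    ∀ n : Fin r → ℕ, ∑ i, n i = N → GoodPoly (H n) := by
  induction N with
  | zero =>
    intro n hn
    have h1 : H n = 1 := (hH n).1.natDegree_eq_zero.1 ((hH n).2.1.trans hn)
    rw [h1]
    exact ⟨⟨0, by simp [ofRoots]⟩, fun x hx => by simp at hx⟩
  | succ N ih =>
    intro n hn
    obtain ⟨l, hl⟩ : ∃ l, n l ≠ 0 := by
      by_contra! hcon
      simp [hcon] at hn
    have hdec : n = (fun i => n i - unitMI l i) + unitMI l := by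
      ext i
      by_cases hi : i = l
      · subst hi; simp [unitMI]; omega
      · simp [unitMI, hi]
    set m : Fin r → ℕ := fun i => n i - unitMI l i
    have hs : ∑ i, (m + unitMI l) i = (∑ i, m i) + 1 := by
      simp [unitMI, sum_add_distrib]
    rw [hdec] at hn ⊢
    rw [MH_raise c hc H hH]
    exact (ih m (by omega)).raise (hH m).1 _

/-- the multiple Hermite polynomials satisfy the Turán inequality
`H_{n+e_j}(x)² − H_{n}(x) H_{n+2e_j}(x) > 0` for all real `x`. -/
theorem multipleHermite_turan_diag {r : ℕ} (hr : 1 ≤ r)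
    (c : Fin r → ℝ) (hc : Function.Injective c)
    (H : (Fin r → ℕ) → Polynomial ℝ) (hH : ∀ n, IsMultipleHermite c n (H n))
    (n : Fin r → ℕ) (j : Fin r) (x : ℝ) :
    0 < (H (n + unitMI j)).eval x ^ 2 -
        (H n).eval x * (H (n + 2 • unitMI j)).eval x := by
  have e2 : n + 2 • unitMI j = (n + unitMI j) + unitMI j := by rw [two_nsmul, add_assoc]
  rw [e2, MH_raise c hc H hH (n + unitMI j), MH_raise c hc H hH n]
  have hp := (MH_good c hc H hH _ n rfl).pos x
  simp only [raise, derivative_sub, derivative_mul, derivative_X, derivative_C, eval_sub,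
    eval_mul, eval_add, eval_X, eval_C, sub_zero, one_mul, zero_mul, zero_add, eval_one]
  nlinarith [hp]
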